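/- arXiv:2410.24040 — 2 statements merged into one kernel-verified Lean document; each statement's English description precedes it below -/
import Mathlib

section
/- Let V be a Banach space, p ≥ 1, ω̄ a control on Δ_T and L > 0. Let g : [0,T] → V be a continuous function with finite localized p-variation with respect to (ω̄, L/2). Then for every (s,t) ∈ Δ_T one has ‖g‖_{p,(ω̄,L),[s,t]}^p ≤ 2^{p−1} ‖g‖_{p,(ω̄,L/2),[s,t]}^p. -/
open Set

/-- The simplex `Δ_T = {(s,t) : 0 ≤ s ≤ t ≤ T}`. -/
def Simplex (T : ℝ) : Set (ℝ × ℝ) := {q | 0 ≤ q.1 ∧ q.1 ≤ q.2 ∧ q.2 ≤ T}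

/-- A control on `Δ_T`: a continuous nonnegative function vanishing on the diagonal
and superadditive. -/
structure IsControl (T : ℝ) (ω : ℝ → ℝ → ℝ) : Prop where
  nonneg : ∀ ⦃s t : ℝ⦄, 0 ≤ s → s ≤ t → t ≤ T → 0 ≤ ω s t
  cont : ContinuousOn (fun q : ℝ × ℝ => ω q.1 q.2) (Simplex T)
  diag : ∀ ⦃s : ℝ⦄, 0 ≤ s → s ≤ T → ω s s = 0
  superadd : ∀ ⦃s u t : ℝ⦄, 0 ≤ s → s ≤ u → u ≤ t → t ≤ T → ω s u + ω u t ≤ ω s t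

/-- A control is strictly positive if it vanishes only on the diagonal. -/
def StrictlyPositive (T : ℝ) (ω : ℝ → ℝ → ℝ) : Prop :=
  ∀ ⦃s t : ℝ⦄, 0 ≤ s → s ≤ t → t ≤ T → ω s t = 0 → s = t

/-- `τ 0 = s < τ 1 < ⋯ < τ N = t` is a partition of `[s,t]`. -/
def IsPartition (s t : ℝ) (N : ℕ) (τ : ℕ → ℝ) : Prop :=
  τ 0 = s ∧ τ N = t ∧ ∀ i < N, τ i < τ (i + 1)

/-- A partition is `(ω̄,L)`-admissible if `ω̄(τ i, τ (i+1)) ≤ L` for every step. -/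
def IsAdmissible (ωb : ℝ → ℝ → ℝ) (L : ℝ) (N : ℕ) (τ : ℕ → ℝ) : Prop :=
  ∀ i < N, ωb (τ i) (τ (i + 1)) ≤ L

/-- The `p`-sum of the two-index function `g` along a partition. -/
noncomputable def pSum {V : Type*} [NormedAddCommGroup V]
    (g : ℝ → ℝ → V) (p : ℝ) (N : ℕ) (τ : ℕ → ℝ) : ℝ :=
  ∑ i ∈ Finset.range N, ‖g (τ i) (τ (i + 1))‖ ^ p

/-- Increments of a one-index function, viewed as a two-index function. -/
def inc {V : Type*} [NormedAddCommGroup V] (f : ℝ → V) : ℝ → ℝ → V :=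
  fun a b => f b - f a

/-- The set of `p`-sums of `g` along `(ω̄,L)`-admissible partitions of `[s,t]`. -/
def locVarSet {V : Type*} [NormedAddCommGroup V] (g : ℝ → ℝ → V) (p : ℝ)
    (ωb : ℝ → ℝ → ℝ) (L s t : ℝ) : Set ℝ :=
  {x | ∃ N τ, IsPartition s t N τ ∧ IsAdmissible ωb L N τ ∧ x = pSum g p N τ}

/-- The localized `p`-variation `‖g‖_{p,(ω̄,L),[s,t]}^p` (raised to the `p`-th power). -/
noncomputable def locVar {V : Type*} [NormedAddCommGroup V] (g : ℝ → ℝ → V) (p : ℝ)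
    (ωb : ℝ → ℝ → ℝ) (L s t : ℝ) : ℝ :=
  sSup (locVarSet g p ωb L s t)

/-- The set of `p`-sums of `g` along arbitrary partitions of `[s,t]`. -/
def varSet {V : Type*} [NormedAddCommGroup V] (g : ℝ → ℝ → V) (p : ℝ) (s t : ℝ) : Set ℝ :=
  {x | ∃ N τ, IsPartition s t N τ ∧ x = pSum g p N τ}

/-- The (unlocalized) `p`-variation `‖g‖_{p,[s,t]}^p` (raised to the `p`-th power). -/
noncomputable def pVar {V : Type*} [NormedAddCommGroup V] (g : ℝ → ℝ → V) (p : ℝ)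
    (s t : ℝ) : ℝ :=
  sSup (varSet g p s t)

/-- Concatenating admissible partitions of `[s,u]` and `[u,t]` adds their `p`-sums. -/
lemma add_mem_locVarSet {V : Type*} [NormedAddCommGroup V] {g : ℝ → ℝ → V} {p : ℝ}
    {ωb : ℝ → ℝ → ℝ} {L s u t x y : ℝ} (hx : x ∈ locVarSet g p ωb L s u)
    (hy : y ∈ locVarSet g p ωb L u t) : x + y ∈ locVarSet g p ωb L s t := by
  obtain ⟨N, σ, ⟨hσ0, hσN, hσ⟩, hσL, rfl⟩ := hx
  obtain ⟨M, τ, ⟨hτ0, hτM, hτ⟩, hτL, rfl⟩ := hy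
  let ρ : ℕ → ℝ := fun i => if i ≤ N then σ i else τ (i - N)
  have hl : ∀ i ≤ N, ρ i = σ i := fun i hi => if_pos hi
  have hr : ∀ i, ρ (N + i) = τ i := by
    intro i
    rcases Nat.eq_zero_or_pos i with rfl | hi
    · rw [add_zero, hl N le_rfl, hσN, hτ0]
    · have h : ¬ N + i ≤ N := by omega
      simp [ρ, h]
  have hsplit : ∀ i < N + M, (i < N ∧ ρ i = σ i ∧ ρ (i + 1) = σ (i + 1)) ∨
      ∃ j < M, ρ i = τ j ∧ ρ (i + 1) = τ (j + 1) := by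
    intro i hi
    rcases lt_or_ge i N with h | h
    · exact Or.inl ⟨h, hl i h.le, hl (i + 1) h⟩
    · obtain ⟨j, rfl⟩ := Nat.exists_eq_add_of_le h
      exact Or.inr ⟨j, by omega, hr j, hr (j + 1)⟩
  refine ⟨N + M, ρ, ⟨(hl 0 N.zero_le).trans hσ0, (hr M).trans hτM, fun i hi => ?_⟩,
    fun i hi => ?_, ?_⟩
  · rcases hsplit i hi with ⟨h, h₁, h₂⟩ | ⟨j, h, h₁, h₂⟩ <;> rw [h₁, h₂]
    exacts [hσ i h, hτ j h]
  · rcases hsplit i hi with ⟨h, h₁, h₂⟩ | ⟨j, h, h₁, h₂⟩ <;> rw [h₁, h₂]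
    exacts [hσL i h, hτL j h]
  · unfold pSum
    rw [Finset.sum_range_add]
    congr 1
    · refine Finset.sum_congr rfl fun i hi => ?_
      have hi := Finset.mem_range.1 hi
      rw [hl i hi.le, hl (i + 1) hi]
    · refine Finset.sum_congr rfl fun i _ => ?_
      rw [hr i, add_assoc, hr (i + 1)]

lemma nonneg_of_mem_locVarSet {V : Type*} [NormedAddCommGroup V] {g : ℝ → ℝ → V} {p : ℝ}
    {ωb : ℝ → ℝ → ℝ} {L s t x : ℝ} (hx : x ∈ locVarSet g p ωb L s t) : 0 ≤ x := by
  obtain ⟨N, τ, -, -, rfl⟩ := hx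
  exact Finset.sum_nonneg fun i _ => by positivity

/-- The trivial partition of `[s,t]`, also in the degenerate case `s = t`. -/
lemma norm_rpow_mem_locVarSet {V : Type*} [NormedAddCommGroup V] {g : ℝ → V} {p : ℝ}
    (hp : 0 < p) {ωb : ℝ → ℝ → ℝ} {L s t : ℝ} (hst : s ≤ t) (h : ωb s t ≤ L) :
    ‖g t - g s‖ ^ p ∈ locVarSet (inc g) p ωb L s t := by
  rcases hst.eq_or_lt with rfl | hlt
  · refine ⟨0, fun _ => s, ⟨rfl, rfl, by simp⟩, fun i hi => absurd hi i.not_lt_zero, ?_⟩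
    simp [pSum, Real.zero_rpow hp.ne']
  · refine ⟨1, fun i => if i = 0 then s else t, ⟨rfl, rfl, ?_⟩, ?_, ?_⟩
    · simpa using hlt
    · simpa [IsAdmissible] using h
    · simp [pSum, inc]

/-- Every interval can be cut into two pieces, each carrying at most half of the control. -/
lemma IsControl.exists_le_half {T : ℝ} {ω : ℝ → ℝ → ℝ} (hω : IsControl T ω) {s t : ℝ}
    (hs : 0 ≤ s) (hst : s ≤ t) (ht : t ≤ T) :
    ∃ u ∈ Icc s t, ω s u ≤ ω s t / 2 ∧ ω u t ≤ ω s t / 2 := by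
  have hc₁ : ContinuousOn (fun u => ω s u) (Icc s t) :=
    hω.cont.comp (f := fun u : ℝ => (s, u)) (by fun_prop)
      fun u hu => ⟨hs, hu.1, hu.2.trans ht⟩
  have hc₂ : ContinuousOn (fun u => ω u t) (Icc s t) :=
    hω.cont.comp (f := fun u : ℝ => (u, t)) (by fun_prop)
      fun u hu => ⟨hs.trans hu.1, hu.2, ht⟩
  have hst0 := hω.nonneg hs hst ht
  obtain ⟨u, hu, h⟩ := intermediate_value_Icc hst (hc₁.sub hc₂) (show (0 : ℝ) ∈ _ by
    simp only [Pi.sub_apply, mem_Icc, hω.diag hs (hst.trans ht), hω.diag (hs.trans hst) ht]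
    constructor <;> linarith)
  have hadd := hω.superadd hs hu.1 hu.2 ht
  simp only [Pi.sub_apply] at h
  exact ⟨u, hu, by linarith, by linarith⟩

lemma locVarSet_inc_nonempty {V : Type*} [NormedAddCommGroup V] (g : ℝ → V) {p : ℝ}
    (hp : 0 < p) {T : ℝ} {ωb : ℝ → ℝ → ℝ} (hωb : IsControl T ωb) {L : ℝ} (hL : 0 < L)
    {s t : ℝ} (hs : 0 ≤ s) (hst : s ≤ t) (ht : t ≤ T) :
    (locVarSet (inc g) p ωb L s t).Nonempty := by
  obtain ⟨n, hn⟩ := pow_unbounded_of_one_lt (ωb s t / L) (one_lt_two : (1 : ℝ) < 2)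
  replace hn : ωb s t ≤ 2 ^ n * L := ((div_lt_iff₀ hL).1 hn).le
  induction n generalizing s t with
  | zero => exact ⟨_, norm_rpow_mem_locVarSet hp hst (by simpa using hn)⟩
  | succ n ih =>
    obtain ⟨u, hu, h₁, h₂⟩ := hωb.exists_le_half hs hst ht
    rw [pow_succ] at hn
    obtain ⟨x, hx⟩ := ih hs hu.1 (hu.2.trans ht) (by linarith)
    obtain ⟨y, hy⟩ := ih (hs.trans hu.1) hu.2 ht (by linarith)
    exact ⟨_, add_mem_locVarSet hx hy⟩

/-- Boundedness of the localized `p`-sums passes to subintervals. -/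
lemma bddAbove_locVarSet_inc_of_subinterval {V : Type*} [NormedAddCommGroup V] {g : ℝ → V}
    {p : ℝ} (hp : 0 < p) {T : ℝ} {ωb : ℝ → ℝ → ℝ} (hωb : IsControl T ωb) {L : ℝ} (hL : 0 < L)
    (hg : BddAbove (locVarSet (inc g) p ωb L 0 T)) {s t : ℝ}
    (hs : 0 ≤ s) (hst : s ≤ t) (ht : t ≤ T) : BddAbove (locVarSet (inc g) p ωb L s t) := by
  obtain ⟨B, hB⟩ := hg
  obtain ⟨a, ha⟩ := locVarSet_inc_nonempty g hp hωb hL le_rfl hs (hst.trans ht)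
  obtain ⟨b, hb⟩ := locVarSet_inc_nonempty g hp hωb hL (hs.trans hst) ht le_rfl
  refine ⟨B, fun x hx => ?_⟩
  have h := hB (add_mem_locVarSet (add_mem_locVarSet ha hx) hb)
  linarith [nonneg_of_mem_locVarSet ha, nonneg_of_mem_locVarSet hb]

/-- Halving every step of an `L`-admissible partition controls its `p`-sum by that of an
`L / 2`-admissible one. -/
lemma exists_mem_locVarSet_half {V : Type*} [NormedAddCommGroup V] (g : ℝ → V) {p : ℝ}
    (hp : 1 ≤ p) {T : ℝ} {ωb : ℝ → ℝ → ℝ} (hωb : IsControl T ωb) {L s t : ℝ} (hs : 0 ≤ s)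
    (ht : t ≤ T) {N : ℕ} {τ : ℕ → ℝ} (hτ : IsPartition s t N τ) (hτL : IsAdmissible ωb L N τ) :
    s ≤ t ∧ ∃ y ∈ locVarSet (inc g) p ωb (L / 2) s t,
      pSum (inc g) p N τ ≤ (2 : ℝ) ^ (p - 1) * y := by
  induction N generalizing t with
  | zero =>
    obtain rfl : s = t := hτ.1.symm.trans hτ.2.1
    exact ⟨le_rfl, 0, ⟨0, τ, hτ, fun i hi => absurd hi i.not_lt_zero, by simp [pSum]⟩,
      by simp [pSum]⟩
  | succ N ih =>
    obtain ⟨h0, hN, hlt⟩ := hτ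
    have hstep : τ N < t := hN ▸ hlt N N.lt_succ_self
    obtain ⟨hsN, y, hy, hle⟩ := ih (hstep.le.trans ht)
      ⟨h0, rfl, fun i hi => hlt i (hi.trans N.lt_succ_self)⟩
      (fun i hi => hτL i (hi.trans N.lt_succ_self))
    have hL := hτL N N.lt_succ_self
    rw [hN] at hL
    obtain ⟨u, hu, h₁, h₂⟩ := hωb.exists_le_half (hs.trans hsN) hstep.le ht
    have hp0 : 0 < p := one_pos.trans_le hp
    refine ⟨hsN.trans hstep.le, _, add_mem_locVarSet hy (add_mem_locVarSet
      (norm_rpow_mem_locVarSet (g := g) hp0 hu.1 (h₁.trans (by linarith)))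
      (norm_rpow_mem_locVarSet (g := g) hp0 hu.2 (h₂.trans (by linarith)))), ?_⟩
    have htri : ‖g t - g (τ N)‖ ≤ ‖g u - g (τ N)‖ + ‖g t - g u‖ := by
      rw [add_comm]
      exact norm_sub_le_norm_sub_add_norm_sub _ _ _
    have hpow : ‖g t - g (τ N)‖ ^ p ≤
        2 ^ (p - 1) * (‖g u - g (τ N)‖ ^ p + ‖g t - g u‖ ^ p) :=
      (Real.rpow_le_rpow (norm_nonneg _) htri hp0.le).trans
        (by exact_mod_cast
          NNReal.rpow_add_le_mul_rpow_add_rpow ‖g u - g (τ N)‖₊ ‖g t - g u‖₊ hp)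
    have hsum : pSum (inc g) p (N + 1) τ = pSum (inc g) p N τ + ‖g t - g (τ N)‖ ^ p := by
      simp [pSum, inc, Finset.sum_range_succ, hN]
    rw [hsum, mul_add]
    exact add_le_add hle hpow

/-- For a continuous path `g` of finite localized `p`-variation with
respect to `(ω̄, L/2)`, one has
`‖g‖_{p,(ω̄,L),[s,t]}^p ≤ 2^(p-1) ‖g‖_{p,(ω̄,L/2),[s,t]}^p`. -/
theorem statement2 {V : Type*} [NormedAddCommGroup V] [NormedSpace ℝ V] [CompleteSpace V]
    (T : ℝ) (hT : 0 < T) (p : ℝ) (hp : 1 ≤ p)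
    (ωb : ℝ → ℝ → ℝ) (hωb : IsControl T ωb) (L : ℝ) (hL : 0 < L)
    (g : ℝ → V) (hgc : ContinuousOn g (Icc 0 T))
    (hgfin : BddAbove (locVarSet (inc g) p ωb (L / 2) 0 T)) :
    ∀ s t : ℝ, (s, t) ∈ Simplex T →
      locVar (inc g) p ωb L s t ≤ (2 : ℝ) ^ (p - 1) * locVar (inc g) p ωb (L / 2) s t := by
  rintro s t ⟨hs, hst, ht⟩
  have hp0 : 0 < p := one_pos.trans_le hp
  refine csSup_le (locVarSet_inc_nonempty g hp0 hωb hL hs hst ht) ?_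
  rintro x ⟨N, τ, hτ, hτL, rfl⟩
  obtain ⟨-, y, hy, hle⟩ := exists_mem_locVarSet_half g hp hωb hs ht hτ hτL
  have hbdd := bddAbove_locVarSet_inc_of_subinterval hp0 hωb (half_pos hL) hgfin hs hst ht
  exact hle.trans (mul_le_mul_of_nonneg_left (le_csSup hbdd hy) (by positivity))
end

section
/- (Localized Sewing Lemma.) Let ξ ∈ (0,1), L > 0, V a Banach space, and let ω and ω̄ be controls on Δ_T. Let h : Δ_T → V be a continuous two-index function such that ‖δh_{s,u,t}‖ ≤ ω(s,t)^{1/ξ} for all 0 ≤ s ≤ u ≤ t ≤ T with ω̄(s,t) ≤ L, where δh_{s,u,t} := h(s,t) − h(s,u) − h(u,t). Then there exists a unique path I : [0,T] → V with I(0) = 0 such that the two-index function Λ(s,t) := I(t) − I(s) − h(s,t) has finite localized ξ-variation with respect to (ω̄,L). Moreover, there exists a constant C_ξ > 0 depending only on ξ such that ‖Λ(s,t)‖ ≤ C_ξ ω(s,t)^{1/ξ} for all (s,t) ∈ Δ_T with ω̄(s,t) ≤ L. In addition, if h has finite localized p-variation with respect to (ω̄,L) for some p ≥ ξ, then I has finite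 p-variation on [0,T]. -/
open Set

section Aux

variable {T L θ p ξ : ℝ} {ω ωb : ℝ → ℝ → ℝ} {V : Type*} [NormedAddCommGroup V]

theorem IsControl.mono (hω : IsControl T ω) {s s' t' t : ℝ} (h0 : 0 ≤ s) (h1 : s ≤ s')
    (h2 : s' ≤ t') (h3 : t' ≤ t) (h4 : t ≤ T) : ω s' t' ≤ ω s t := by
  have a1 := hω.superadd h0 h1 (h2.trans h3) h4
  have a2 := hω.superadd (h0.trans h1) h2 h3 h4
  have a3 := hω.nonneg h0 h1 (by linarith)
  have a4 := hω.nonneg (by linarith : 0 ≤ t') h3 h4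
  linarith

theorem le_of_step_le {τ : ℕ → ℝ} {N : ℕ} (hτ : ∀ i < N, τ i ≤ τ (i + 1)) {i j : ℕ}
    (hij : i ≤ j) (hj : j ≤ N) : τ i ≤ τ j := by
  induction j, hij using Nat.le_induction with
  | base => exact le_rfl
  | succ j _ ih => exact (ih (by omega)).trans (hτ j (by omega))

theorem IsControl.sum_le (hω : IsControl T ω) {τ : ℕ → ℝ} {N : ℕ}
    (hτ : ∀ i < N, τ i ≤ τ (i + 1)) (h0 : 0 ≤ τ 0) (hT : τ N ≤ T) :
    ∑ i ∈ Finset.range N, ω (τ i) (τ (i + 1)) ≤ ω (τ 0) (τ N) := by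
  have key : ∀ n ≤ N, ∑ i ∈ Finset.range n, ω (τ i) (τ (i + 1)) ≤ ω (τ 0) (τ n) := by
    intro n
    induction n with
    | zero =>
      intro _
      simp [hω.diag h0 ((le_of_step_le hτ (Nat.zero_le N) le_rfl).trans hT)]
    | succ n ih =>
      intro hn
      rw [Finset.sum_range_succ]
      have h1 := ih (by omega)
      have h2 := hω.superadd h0 (le_of_step_le hτ (Nat.zero_le n) (by omega)) (hτ n (by omega))
        ((le_of_step_le hτ hn le_rfl).trans hT)
      linarith
  exact key N le_rfl

/-- A continuous function on the simplex vanishing on the diagonal is uniformly small near it. -/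
theorem exists_mesh {E : Type*} [NormedAddCommGroup E] {g : ℝ → ℝ → E}
    (hg : ContinuousOn (fun q : ℝ × ℝ => g q.1 q.2) (Simplex T))
    (hd : ∀ s, 0 ≤ s → s ≤ T → g s s = 0) {ε : ℝ} (hε : 0 < ε) :
    ∃ δ > 0, ∀ s t, 0 ≤ s → s ≤ t → t ≤ T → t - s < δ → ‖g s t‖ < ε := by
  have hcomp : IsCompact (Simplex T) := by
    refine (isCompact_Icc (a := ((0 : ℝ), (0 : ℝ))) (b := (T, T))).of_isClosed_subset ?_ ?_
    · exact (isClosed_le continuous_const continuous_fst).inter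
        ((isClosed_le continuous_fst continuous_snd).inter
          (isClosed_le continuous_snd continuous_const))
    · rintro ⟨a, b⟩ ⟨h1, h2, h3⟩
      simp only at h1 h2 h3
      exact ⟨⟨h1, h1.trans h2⟩, ⟨h2.trans h3, h3⟩⟩
  have huc := hcomp.uniformContinuousOn_of_continuous hg
  rw [Metric.uniformContinuousOn_iff] at huc
  obtain ⟨δ, hδ, H⟩ := huc ε hε
  refine ⟨δ, hδ, fun s t h0 hst hT hd' => ?_⟩
  have := H (s, t) ⟨h0, hst, hT⟩ (s, s) ⟨h0, le_rfl, hst.trans hT⟩ (by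
    rw [Prod.dist_eq]
    simp [Real.dist_eq, abs_of_nonneg (sub_nonneg.2 hst), hδ, hd'])
  simpa [hd s h0 (hst.trans hT)] using this

/-- The uniform grid of mesh `T / n`, clamped to `[a,b]`. -/
noncomputable def grid (T : ℝ) (n : ℕ) (a b : ℝ) (i : ℕ) : ℝ :=
  max a (min (i * T / n) b)

theorem grid_mono (hT : 0 ≤ T) (n : ℕ) (a b : ℝ) : Monotone (grid T n a b) := by
  intro i j hij
  unfold grid
  gcongr

theorem le_grid (n : ℕ) (a b : ℝ) (i : ℕ) : a ≤ grid T n a b i := le_max_left _ _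

theorem grid_le (n : ℕ) {a b : ℝ} (hab : a ≤ b) (i : ℕ) : grid T n a b i ≤ b :=
  max_le hab (min_le_right _ _)

theorem grid_zero (n : ℕ) {a : ℝ} (b : ℝ) (ha : 0 ≤ a) : grid T n a b 0 = a := by
  unfold grid
  simp [ha]

theorem grid_self {n : ℕ} (hn : 0 < n) {a b : ℝ} (hab : a ≤ b) (hb : b ≤ T) :
    grid T n a b n = b := by
  have : (n : ℝ) ≠ 0 := by positivity
  unfold grid
  rw [mul_div_cancel_left₀ _ this, min_eq_right hb, max_eq_right hab]

theorem grid_step (hT : 0 ≤ T) (n : ℕ) (a b : ℝ) (i : ℕ) :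
    grid T n a b (i + 1) - grid T n a b i ≤ T / n := by
  have h0 : 0 ≤ T / n := by positivity
  have h1 : ((i + 1 : ℕ) : ℝ) * T / n = i * T / n + T / n := by push_cast; ring
  unfold grid
  rw [h1, sub_le_iff_le_add]
  refine max_le ?_ ?_
  · linarith [le_max_left a (min (i * T / n) b)]
  · have h2 : min (i * T / n + T / n) b ≤ min (i * T / n) b + T / n := by
      rcases le_total (i * T / n) b with h | h
      · rw [min_eq_left h]; exact min_le_left _ _
      · rw [min_eq_right h]; linarith [min_le_right (i * T / n + T / n) b]
    linarith [le_max_right a (min (i * T / n) b)]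

theorem grid_mul {n k : ℕ} (hk : 0 < k) (a b : ℝ) (i : ℕ) :
    grid T (n * k) a b (i * k) = grid T n a b i := by
  have : (k : ℝ) ≠ 0 := by positivity
  unfold grid
  congr 2
  push_cast
  rw [show (i : ℝ) * k * T = (i * T) * k by ring, mul_div_mul_right _ _ this]

theorem eventually_grid {P : ℝ → ℝ → Prop} (hT : 0 ≤ T)
    (hP : ∃ δ > 0, ∀ s t, 0 ≤ s → s ≤ t → t ≤ T → t - s < δ → P s t) :
    ∃ N : ℕ, ∀ n, N ≤ n → 0 < n → ∀ a b, 0 ≤ a → a ≤ b → b ≤ T → ∀ i,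
      P (grid T n a b i) (grid T n a b (i + 1)) := by
  obtain ⟨δ, hδ, H⟩ := hP
  obtain ⟨N, hN⟩ := exists_nat_gt (T / δ)
  refine ⟨N, fun n hn hn0 a b ha hab hb i => H _ _ (ha.trans (le_grid _ _ _ _))
    (grid_mono hT _ _ _ (Nat.le_succ i)) ((grid_le _ hab _).trans hb) ?_⟩
  refine (grid_step hT n a b i).trans_lt ?_
  have hn' : (0 : ℝ) < n := by positivity
  have : (N : ℝ) ≤ n := by exact_mod_cast hn
  rw [div_lt_iff₀ hδ] at hN
  rw [div_lt_iff₀ hn']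
  nlinarith

theorem sum_range_blocks {M : Type*} [AddCommMonoid M] (f : ℕ → M) (N k : ℕ) :
    ∑ i ∈ Finset.range N, ∑ j ∈ Finset.Ico (i * k) ((i + 1) * k), f j
      = ∑ j ∈ Finset.range (N * k), f j := by
  induction N with
  | zero => simp
  | succ N ih =>
    rw [Finset.sum_range_succ, ih, Finset.range_eq_Ico, Finset.range_eq_Ico,
      Finset.sum_Ico_consecutive _ (Nat.zero_le _) (Nat.mul_le_mul_right _ (Nat.le_succ N))]

/-- `h` is additive up to `ω ^ θ` on intervals with `ω̄ ≤ L`. -/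
def IsAlmostAdditive (T L θ : ℝ) (ω ωb : ℝ → ℝ → ℝ) (h : ℝ → ℝ → V) : Prop :=
  ∀ s u t : ℝ, 0 ≤ s → s ≤ u → u ≤ t → t ≤ T → ωb s t ≤ L →
    ‖h s t - h s u - h u t‖ ≤ ω s t ^ θ

variable {h : ℝ → ℝ → V}

theorem IsAlmostAdditive.diag (hh : IsAlmostAdditive T L θ ω ωb h) (hθ : 1 < θ) (hL : 0 < L)
    (hω : IsControl T ω) (hωb : IsControl T ωb) (s : ℝ) (h0 : 0 ≤ s) (hT : s ≤ T) :
    h s s = 0 := by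
  have := hh s s s h0 le_rfl le_rfl hT (by rw [hωb.diag h0 hT]; exact hL.le)
  rw [hω.diag h0 hT, Real.zero_rpow (by linarith)] at this
  simpa using this

/-- The constant in the sewing bound for the exponent `θ`. -/
noncomputable def sewConst (θ : ℝ) : ℝ := 2 / (1 - 2 * (1 / 2 : ℝ) ^ θ)

theorem half_rpow_lt (hθ : 1 < θ) : 2 * (1 / 2 : ℝ) ^ θ < 1 := by
  have := Real.rpow_lt_rpow_of_exponent_gt (x := (1 / 2 : ℝ)) (by norm_num) (by norm_num) hθ
  rw [Real.rpow_one] at this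
  linarith

theorem sewConst_pos (hθ : 1 < θ) : 0 < sewConst θ := by
  have := half_rpow_lt hθ
  unfold sewConst
  exact div_pos two_pos (by linarith)

theorem sewConst_eq (hθ : 1 < θ) :
    sewConst θ = 2 * (sewConst θ * (1 / 2 : ℝ) ^ θ) + 2 := by
  have := half_rpow_lt hθ
  have h1 : sewConst θ * (1 - 2 * (1 / 2 : ℝ) ^ θ) = 2 := div_mul_cancel₀ _ (by linarith)
  linarith

theorem IsAlmostAdditive.norm_sum_sub_le (hh : IsAlmostAdditive T L θ ω ωb h) (hθ : 1 < θ)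
    (hL : 0 < L) (hω : IsControl T ω) (hωb : IsControl T ωb) {τ : ℕ → ℝ} (hτ : Monotone τ)
    (h0 : ∀ i, 0 ≤ τ i) (hT : ∀ i, τ i ≤ T) {a b : ℕ} (hab : a ≤ b)
    (hLab : ωb (τ a) (τ b) ≤ L) :
    ‖(∑ i ∈ Finset.Ico a b, h (τ i) (τ (i + 1))) - h (τ a) (τ b)‖
      ≤ sewConst θ * ω (τ a) (τ b) ^ θ := by
  have hC := sewConst_pos hθ
  induction hn : b - a using Nat.strong_induction_on generalizing a b with
  | _ n ih =>
  rcases hab.eq_or_lt with rfl | hlt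
  · simp only [Finset.Ico_self, Finset.sum_empty,
      hh.diag hθ hL hω hωb _ (h0 a) (hT a), sub_zero, norm_zero]
    exact mul_nonneg hC.le (Real.rpow_nonneg (hω.nonneg (h0 _) le_rfl (hT _)) _)
  classical
  set W := ω (τ a) (τ b) with hW
  have hW0 : 0 ≤ W := hω.nonneg (h0 _) (hτ hab) (hT _)
  let Q : ℕ → Prop := fun j => a ≤ j ∧ ω (τ a) (τ j) ≤ W / 2
  have hQa : Q a := ⟨le_rfl, by rw [hω.diag (h0 _) (hT _)]; positivity⟩
  set k := Nat.findGreatest Q (b - 1) with hk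
  have hkQ : Q k := Nat.findGreatest_spec (P := Q) (m := a) (by omega) hQa
  have hkb : k ≤ b - 1 := Nat.findGreatest_le _
  have hak : a ≤ k := hkQ.1
  have hright : ω (τ (k + 1)) (τ b) ≤ W / 2 := by
    rcases Nat.lt_or_ge (b - 1) (k + 1) with h1 | h1
    · have : k + 1 = b := by omega
      rw [this, hω.diag (h0 _) (hT _)]; positivity
    · have h2 : ¬ Q (k + 1) := Nat.findGreatest_is_greatest (by omega) h1
      have h3 : W / 2 < ω (τ a) (τ (k + 1)) := by
        by_contra! h4
        exact h2 ⟨by omega, h4⟩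
      have h4 := hω.superadd (h0 a) (hτ (by omega : a ≤ k + 1)) (hτ (by omega : k + 1 ≤ b)) (hT b)
      linarith
  have hτ1 : τ a ≤ τ k := hτ hak
  have hτ2 : τ k ≤ τ (k + 1) := hτ (by omega)
  have hτ3 : τ (k + 1) ≤ τ b := hτ (by omega)
  have e1 := ih (k - a) (by omega) hak
    ((hωb.mono (h0 a) le_rfl hτ1 (hτ2.trans hτ3) (hT b)).trans hLab) rfl
  have e2 := ih (b - (k + 1)) (by omega) (by omega : k + 1 ≤ b)
    ((hωb.mono (h0 a) (hτ1.trans hτ2) hτ3 le_rfl (hT b)).trans hLab) rfl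
  have hhalf : ∀ x, 0 ≤ x → x ≤ W / 2 →
      sewConst θ * x ^ θ ≤ sewConst θ * (1 / 2 : ℝ) ^ θ * W ^ θ := by
    intro x hx0 hx
    rw [mul_assoc, ← Real.mul_rpow (by norm_num) hW0]
    gcongr
    linarith
  replace e1 := e1.trans (hhalf _ (hω.nonneg (h0 _) hτ1 (hT _)) hkQ.2)
  replace e2 := e2.trans (hhalf _ (hω.nonneg (h0 _) hτ3 (hT _)) hright)
  have d1 := hh _ _ _ (h0 a) hτ1 (hτ2.trans hτ3) (hT b) hLab
  have d2 := (hh _ _ _ (h0 k) hτ2 hτ3 (hT b)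
    ((hωb.mono (h0 a) hτ1 (hτ2.trans hτ3) le_rfl (hT b)).trans hLab)).trans
    (Real.rpow_le_rpow (hω.nonneg (h0 k) (hτ2.trans hτ3) (hT b))
      (hω.mono (h0 a) hτ1 (hτ2.trans hτ3) le_rfl (hT b)) (by linarith))
  rw [← Finset.sum_Ico_consecutive _ hak (by omega : k ≤ b),
    Finset.sum_eq_sum_Ico_succ_bot (by omega : k < b)]
  set S1 := ∑ i ∈ Finset.Ico a k, h (τ i) (τ (i + 1))
  set S2 := ∑ i ∈ Finset.Ico (k + 1) b, h (τ i) (τ (i + 1))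
  have split : S1 + (h (τ k) (τ (k + 1)) + S2) - h (τ a) (τ b)
      = (S1 - h (τ a) (τ k)) + (S2 - h (τ (k + 1)) (τ b))
        - (h (τ a) (τ b) - h (τ a) (τ k) - h (τ k) (τ b))
        - (h (τ k) (τ b) - h (τ k) (τ (k + 1)) - h (τ (k + 1)) (τ b)) := by abel
  rw [split]
  refine (norm_sub_le_of_le (norm_sub_le_of_le (norm_add_le_of_le e1 e2) d1) d2).trans ?_
  have := sewConst_eq hθ
  have e3 : sewConst θ * W ^ θ = (2 * (sewConst θ * (1 / 2 : ℝ) ^ θ) + 2) * W ^ θ := by rw [← this]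
  rw [e3]
  linarith

theorem rpow_le_mul_self {x y q : ℝ} (hx : 0 ≤ x) (hxy : x ≤ y) (hq : 1 ≤ q) :
    x ^ q ≤ y ^ (q - 1) * x := by
  rcases hx.eq_or_lt with rfl | hx'
  · rw [Real.zero_rpow (by linarith)]; simp
  · calc x ^ q = x ^ (q - 1) * x := by
          rw [← Real.rpow_add_one hx'.ne']; congr 1; ring
      _ ≤ y ^ (q - 1) * x := by
          gcongr

theorem eventually_sum_grid_rpow_le (hT : 0 < T) (hL : 0 < L) (hθ : 1 < θ) (hω : IsControl T ω)
    (hωb : IsControl T ωb) {ε : ℝ} (hε : 0 < ε) :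
    ∃ N : ℕ, ∀ n, N ≤ n → 0 < n → ∀ a b, 0 ≤ a → a ≤ b → b ≤ T →
      (∀ i, ωb (grid T n a b i) (grid T n a b (i + 1)) ≤ L) ∧
      ∑ i ∈ Finset.range n, ω (grid T n a b i) (grid T n a b (i + 1)) ^ θ ≤ ε := by
  have hW : 0 ≤ ω 0 T := hω.nonneg le_rfl hT.le le_rfl
  obtain ⟨η, hη0, hη⟩ : ∃ η : ℝ, 0 < η ∧ η ^ (θ - 1) * ω 0 T ≤ ε := by
    have hc : Filter.Tendsto (fun x : ℝ => x ^ (θ - 1) * ω 0 T) (nhdsWithin 0 (Ioi 0))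
        (nhds 0) := by
      have : ContinuousAt (fun x : ℝ => x ^ (θ - 1) * ω 0 T) 0 :=
        (Real.continuousAt_rpow_const _ _ (Or.inr (by linarith))).mul continuousAt_const
      have h2 := this.tendsto
      simp only [Real.zero_rpow (by linarith : θ - 1 ≠ 0), zero_mul] at h2
      exact h2.mono_left nhdsWithin_le_nhds
    obtain ⟨η, h1, h2⟩ := ((hc.eventually_le_const hε).and self_mem_nhdsWithin).exists
    exact ⟨η, h2, h1⟩
  obtain ⟨N1, H1⟩ := eventually_grid hT.le (exists_mesh hω.cont (fun s => hω.diag (s := s)) hη0)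
  obtain ⟨N2, H2⟩ := eventually_grid hT.le (exists_mesh hωb.cont (fun s => hωb.diag (s := s)) hL)
  refine ⟨max N1 N2, fun n hn hn0 a b ha hab hb => ⟨fun i => ?_, ?_⟩⟩
  · exact (le_abs_self _).trans (H2 n (le_of_max_le_right hn) hn0 a b ha hab hb i).le
  · have hm := grid_mono hT.le n a b
    have hω0 : ∀ i, 0 ≤ ω (grid T n a b i) (grid T n a b (i + 1)) := fun i =>
      hω.nonneg (ha.trans (le_grid _ _ _ _)) (hm (Nat.le_succ i)) ((grid_le _ hab _).trans hb)
    calc ∑ i ∈ Finset.range n, ω (grid T n a b i) (grid T n a b (i + 1)) ^ θ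
        ≤ ∑ i ∈ Finset.range n, η ^ (θ - 1) * ω (grid T n a b i) (grid T n a b (i + 1)) := by
          refine Finset.sum_le_sum fun i _ => rpow_le_mul_self (hω0 i) ?_ hθ.le
          exact (le_abs_self _).trans (H1 n (le_of_max_le_left hn) hn0 a b ha hab hb i).le
      _ ≤ η ^ (θ - 1) * ω 0 T := by
          rw [← Finset.mul_sum]
          gcongr
          refine (hω.sum_le (fun i _ => hm (Nat.le_succ i)) (ha.trans (le_grid _ _ _ _))
            ((grid_le _ hab _).trans hb)).trans ?_
          exact hω.mono le_rfl (ha.trans (le_grid _ _ _ _)) (hm (Nat.zero_le n))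
            ((grid_le _ hab _).trans hb) le_rfl
      _ ≤ ε := hη

/-- The Riemann sum of `h` along the grid of mesh `T / n` in `[a,b]`. -/
noncomputable def gridSum (T : ℝ) (h : ℝ → ℝ → V) (n : ℕ) (a b : ℝ) : V :=
  ∑ i ∈ Finset.range n, h (grid T n a b i) (grid T n a b (i + 1))

theorem IsAlmostAdditive.norm_gridSum_mul_sub_le (hh : IsAlmostAdditive T L θ ω ωb h) (hT : 0 < T)
    (hθ : 1 < θ) (hL : 0 < L) (hω : IsControl T ω) (hωb : IsControl T ωb) {a b : ℝ} (ha : 0 ≤ a)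
    (hab : a ≤ b) (hb : b ≤ T) {n k : ℕ} (hk : 0 < k)
    (hLn : ∀ i, ωb (grid T n a b i) (grid T n a b (i + 1)) ≤ L) :
    ‖gridSum T h (n * k) a b - gridSum T h n a b‖
      ≤ sewConst θ * ∑ i ∈ Finset.range n, ω (grid T n a b i) (grid T n a b (i + 1)) ^ θ := by
  unfold gridSum
  rw [← sum_range_blocks, ← Finset.sum_sub_distrib, Finset.mul_sum]
  refine norm_sum_le_of_le _ fun i _ => ?_
  rw [← grid_mul hk a b i, ← grid_mul hk a b (i + 1)]
  refine hh.norm_sum_sub_le hθ hL hω hωb (grid_mono hT.le _ _ _)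
    (fun j => ha.trans (le_grid _ _ _ _)) (fun j => (grid_le _ hab _).trans hb)
    (Nat.mul_le_mul_right _ (Nat.le_succ i)) ?_
  rw [grid_mul hk, grid_mul hk]
  exact hLn i

theorem IsAlmostAdditive.cauchySeq_gridSum (hh : IsAlmostAdditive T L θ ω ωb h) (hT : 0 < T)
    (hθ : 1 < θ) (hL : 0 < L) (hω : IsControl T ω) (hωb : IsControl T ωb) {a b : ℝ} (ha : 0 ≤ a)
    (hab : a ≤ b) (hb : b ≤ T) : CauchySeq fun n => gridSum T h n a b := by
  rw [Metric.cauchySeq_iff']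
  intro ε hε
  have hC := sewConst_pos hθ
  obtain ⟨N, hN⟩ := eventually_sum_grid_rpow_le hT hL hθ hω hωb
    (show 0 < ε / (4 * sewConst θ) by positivity)
  have key : ∀ n ≥ N + 1, ∀ k, 0 < k →
      ‖gridSum T h (n * k) a b - gridSum T h n a b‖ ≤ ε / 4 := by
    intro n hn k hk
    obtain ⟨h1, h2⟩ := hN n (by omega) (by omega) a b ha hab hb
    refine (hh.norm_gridSum_mul_sub_le hT hθ hL hω hωb ha hab hb hk h1).trans ?_
    calc _ ≤ sewConst θ * (ε / (4 * sewConst θ)) := by gcongr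
      _ = ε / 4 := by field_simp
  refine ⟨N + 1, fun n hn => ?_⟩
  have h1 := key n hn (N + 1) (by omega)
  have h2 := key (N + 1) le_rfl n (by omega)
  rw [mul_comm n] at h1
  rw [dist_eq_norm]
  calc ‖gridSum T h n a b - gridSum T h (N + 1) a b‖
      = ‖(gridSum T h ((N + 1) * n) a b - gridSum T h (N + 1) a b)
        - (gridSum T h ((N + 1) * n) a b - gridSum T h n a b)‖ := by congr 1; abel
    _ ≤ _ := norm_sub_le _ _
    _ < ε := by linarith

theorem IsAlmostAdditive.norm_min_max_le (hh : IsAlmostAdditive T L θ ω ωb h) (hθ : 1 < θ)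
    (hL : 0 < L) (hω : IsControl T ω) (hωb : IsControl T ωb) {x y s : ℝ} (hx : 0 ≤ x) (hxy : x ≤ y)
    (hy : y ≤ T) (hs : 0 ≤ s) (hsT : s ≤ T) (hxL : ωb x y ≤ L) :
    ‖h x y - h (min x s) (min y s) - h (max x s) (max y s)‖ ≤ ω x y ^ θ := by
  have hd := hh.diag hθ hL hω hωb s hs hsT
  have h0 : 0 ≤ ω x y ^ θ := Real.rpow_nonneg (hω.nonneg hx hxy hy) _
  rcases le_total y s with h1 | h1
  · simpa [h1, hxy.trans h1, hd] using h0
  · rcases le_total x s with h2 | h2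
    · simpa [h1, h2] using hh x s y hx h2 h1 hy hxL
    · simpa [h1, h2, hd] using h0

theorem IsAlmostAdditive.norm_gridSum_sub_sub_le (hh : IsAlmostAdditive T L θ ω ωb h) (hT : 0 < T)
    (hθ : 1 < θ) (hL : 0 < L) (hω : IsControl T ω) (hωb : IsControl T ωb) {s t : ℝ} (hs : 0 ≤ s)
    (hst : s ≤ t) (ht : t ≤ T) {n : ℕ}
    (hLn : ∀ i, ωb (grid T n 0 t i) (grid T n 0 t (i + 1)) ≤ L) :
    ‖gridSum T h n 0 t - gridSum T h n 0 s - gridSum T h n s t‖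
      ≤ ∑ i ∈ Finset.range n, ω (grid T n 0 t i) (grid T n 0 t (i + 1)) ^ θ := by
  have e1 : ∀ i, grid T n 0 s i = min (grid T n 0 t i) s := fun i => by
    unfold grid
    rw [max_min_distrib_left, max_eq_right hs, max_min_distrib_left, max_eq_right (hs.trans hst),
      min_assoc, min_eq_right hst]
  have e2 : ∀ i, grid T n s t i = max (grid T n 0 t i) s := fun i => by
    unfold grid
    rw [max_comm, max_comm (0 : ℝ), max_assoc, max_eq_right hs]
  unfold gridSum
  simp only [← Finset.sum_sub_distrib]
  refine norm_sum_le_of_le _ fun i _ => ?_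
  rw [e1, e1, e2, e2]
  exact hh.norm_min_max_le hθ hL hω hωb (le_grid _ _ _ _)
    (grid_mono hT.le _ _ _ (Nat.le_succ i)) ((grid_le _ (hs.trans hst) _).trans ht) hs
    (hst.trans ht) (hLn i)

theorem IsAlmostAdditive.exists_sewing [CompleteSpace V] (hh : IsAlmostAdditive T L θ ω ωb h)
    (hT : 0 < T) (hθ : 1 < θ) (hL : 0 < L) (hω : IsControl T ω) (hωb : IsControl T ωb) :
    ∃ I : ℝ → V, I 0 = 0 ∧ ∀ s t, 0 ≤ s → s ≤ t → t ≤ T → ωb s t ≤ L →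
      ‖I t - I s - h s t‖ ≤ sewConst θ * ω s t ^ θ := by
  have hex : ∀ t : ℝ, ∃ v : V, 0 ≤ t → t ≤ T →
      Filter.Tendsto (fun n => gridSum T h n 0 t) Filter.atTop (nhds v) := by
    intro t
    by_cases ht : 0 ≤ t ∧ t ≤ T
    · obtain ⟨v, hv⟩ := cauchySeq_tendsto_of_complete
        (hh.cauchySeq_gridSum hT hθ hL hω hωb le_rfl ht.1 ht.2)
      exact ⟨v, fun _ _ => hv⟩
    · exact ⟨0, fun h1 h2 => absurd ⟨h1, h2⟩ ht⟩
  choose I hI using hex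
  refine ⟨I, ?_, ?_⟩
  · refine tendsto_nhds_unique (hI 0 le_rfl hT.le) ?_
    have : ∀ n, gridSum T h n 0 0 = 0 := fun n => by
      refine Finset.sum_eq_zero fun i _ => ?_
      have : ∀ i, grid T n 0 0 i = 0 := fun i =>
        le_antisymm (grid_le _ le_rfl _) (le_grid _ _ _ _)
      rw [this, this, hh.diag hθ hL hω hωb 0 le_rfl hT.le]
    simp [this]
  · intro s t hs hst ht hLst
    refine le_of_forall_pos_le_add fun ε hε => ?_
    have hlim : Filter.Tendsto (fun n => ‖gridSum T h n 0 t - gridSum T h n 0 s - h s t‖)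
        Filter.atTop (nhds ‖I t - I s - h s t‖) :=
      (((hI t (hs.trans hst) ht).sub (hI s hs (hst.trans ht))).sub tendsto_const_nhds).norm
    obtain ⟨N, hN⟩ := eventually_sum_grid_rpow_le hT hL hθ hω hωb hε
    refine le_of_tendsto hlim ?_
    filter_upwards [Filter.eventually_ge_atTop (N + 1)] with n hn
    obtain ⟨h1, h2⟩ := hN n (by omega) (by omega) 0 t le_rfl (hs.trans hst) ht
    have b1 := (hh.norm_gridSum_sub_sub_le hT hθ hL hω hωb hs hst ht h1).trans h2
    have g0 : grid T n s t 0 = s := grid_zero n t hs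
    have gn : grid T n s t n = t := grid_self (by omega) hst ht
    have b2 := hh.norm_sum_sub_le hθ hL hω hωb (grid_mono hT.le n s t)
      (fun j => hs.trans (le_grid _ _ _ _)) (fun j => (grid_le _ hst _).trans ht)
      (Nat.zero_le n) (by rw [g0, gn]; exact hLst)
    rw [g0, gn, ← Finset.range_eq_Ico] at b2
    change ‖gridSum T h n s t - h s t‖ ≤ _ at b2
    calc _ = ‖(gridSum T h n s t - h s t)
          + (gridSum T h n 0 t - gridSum T h n 0 s - gridSum T h n s t)‖ := by congr 1; abel
      _ ≤ _ := norm_add_le _ _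
      _ ≤ _ := add_le_add b2 b1

theorem continuousOn_of_small_increments {I : ℝ → V} (hI : ∀ ε > 0, ∃ δ > 0, ∀ s t, 0 ≤ s →
    s ≤ t → t ≤ T → t - s < δ → ‖I t - I s‖ < ε) : ContinuousOn I (Icc 0 T) := by
  rw [Metric.continuousOn_iff]
  intro b hb ε hε
  obtain ⟨δ, hδ, H⟩ := hI ε hε
  refine ⟨δ, hδ, fun a ha hab => ?_⟩
  rw [Real.dist_eq, abs_lt] at hab
  rcases le_total a b with h1 | h1
  · rw [dist_comm, dist_eq_norm]
    exact H a b ha.1 h1 hb.2 (by linarith)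
  · rw [dist_eq_norm]
    exact H b a hb.1 h1 ha.2 (by linarith)

theorem continuousOn_of_sewing_bound {I : ℝ → V} {C : ℝ} (hθ : 1 < θ)
    (hL : 0 < L) (hω : IsControl T ω) (hωb : IsControl T ωb)
    (hh : IsAlmostAdditive T L θ ω ωb h)
    (hc : ContinuousOn (fun q : ℝ × ℝ => h q.1 q.2) (Simplex T))
    (hI : ∀ s t, 0 ≤ s → s ≤ t → t ≤ T → ωb s t ≤ L → ‖I t - I s - h s t‖ ≤ C * ω s t ^ θ) :
    ContinuousOn I (Icc 0 T) := by
  refine continuousOn_of_small_increments fun ε hε => ?_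
  obtain ⟨δ1, h1, H1⟩ := exists_mesh hc (hh.diag hθ hL hω hωb) (half_pos hε)
  obtain ⟨δ2, h2, H2⟩ := exists_mesh (g := fun s t => C * ω s t ^ θ)
    (continuousOn_const.mul (hω.cont.rpow_const fun _ _ => Or.inr (by linarith)))
    (fun s a b => by simp [hω.diag a b, Real.zero_rpow (by linarith : θ ≠ 0)]) (half_pos hε)
  obtain ⟨δ3, h3, H3⟩ := exists_mesh hωb.cont (fun s => hωb.diag (s := s)) hL
  refine ⟨min δ1 (min δ2 δ3), by positivity, fun s t a b c d => ?_⟩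
  rw [lt_min_iff, lt_min_iff] at d
  have e1 := H1 s t a b c d.1
  have e2 := (le_abs_self _).trans_lt (H2 s t a b c d.2.1)
  have e3 := hI s t a b c ((le_abs_self _).trans (H3 s t a b c d.2.2).le)
  have e4 := norm_add_le (I t - I s - h s t) (h s t)
  rw [sub_add_cancel] at e4
  linarith

/-! ### Sums along partitions -/

theorem locVarSet_zero (g : ℝ → ℝ → V) (a : ℝ) : (0 : ℝ) ∈ locVarSet g p ωb L a a :=
  ⟨0, fun _ => a, ⟨rfl, rfl, by simp⟩, fun i hi => absurd hi (Nat.not_lt_zero i), by simp [pSum]⟩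

theorem locVarSet_single (g : ℝ → ℝ → V) {a b : ℝ} (hab : a < b) (hL : ωb a b ≤ L) :
    ‖g a b‖ ^ p ∈ locVarSet g p ωb L a b := by
  refine ⟨1, fun i => if i = 0 then a else b, ⟨by simp, by simp, ?_⟩, ?_, by simp [pSum]⟩
  · intro i hi
    obtain rfl : i = 0 := by omega
    simpa using hab
  · intro i hi
    obtain rfl : i = 0 := by omega
    simpa using hL

theorem locVarSet_add {g : ℝ → ℝ → V} {a b c x y : ℝ} (hx : x ∈ locVarSet g p ωb L a b)
    (hy : y ∈ locVarSet g p ωb L b c) : x + y ∈ locVarSet g p ωb L a c := by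
  obtain ⟨N, τ, ⟨t0, tN, tm⟩, ta, rfl⟩ := hx
  obtain ⟨M, σ, ⟨s0, sM, sm⟩, sa, rfl⟩ := hy
  let ρ : ℕ → ℝ := fun i => if i ≤ N then τ i else σ (i - N)
  have r1 : ∀ i, i ≤ N → ρ i = τ i := fun i hi => if_pos hi
  have r2 : ∀ i, ρ (N + i) = σ i := fun i => by
    rcases Nat.eq_zero_or_pos i with rfl | hi
    · rw [Nat.add_zero, r1 N le_rfl, tN, s0]
    · simp only [ρ]
      rw [if_neg (by omega), Nat.add_sub_cancel_left]
  have key : ∀ P : ℝ → ℝ → Prop, (∀ i < N, P (τ i) (τ (i + 1))) → (∀ i < M, P (σ i) (σ (i + 1))) →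
      ∀ i < N + M, P (ρ i) (ρ (i + 1)) := by
    intro P h1 h2 i hi
    rcases Nat.lt_or_ge i N with h | h
    · rw [r1 i h.le, r1 (i + 1) h]; exact h1 i h
    · obtain ⟨j, rfl⟩ := Nat.exists_eq_add_of_le h
      rw [r2, add_assoc, r2]; exact h2 j (by omega)
  refine ⟨N + M, ρ, ⟨by rw [r1 0 (Nat.zero_le _), t0], by rw [r2, sM],
    key (fun x y => x < y) tm sm⟩, key (fun x y => ωb x y ≤ L) ta sa, ?_⟩
  unfold pSum
  rw [Finset.sum_range_add]
  congr 1
  · refine Finset.sum_congr rfl fun i hi => ?_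
    have := Finset.mem_range.1 hi
    rw [r1 i (by omega), r1 (i + 1) (by omega)]
  · refine Finset.sum_congr rfl fun i _ => ?_
    rw [r2, add_assoc, r2]

theorem locVarSet_sum {g : ℝ → ℝ → V} {τ x : ℕ → ℝ} {N : ℕ}
    (hx : ∀ i < N, x i ∈ locVarSet g p ωb L (τ i) (τ (i + 1))) :
    ∑ i ∈ Finset.range N, x i ∈ locVarSet g p ωb L (τ 0) (τ N) := by
  induction N with
  | zero => simpa using locVarSet_zero g (τ 0)
  | succ N ih =>
    rw [Finset.sum_range_succ]
    exact locVarSet_add (ih fun i hi => hx i (by omega)) (hx N (by omega))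

theorem locVarSet_grid {g : ℝ → ℝ → V} (hT : 0 < T) (hp : 0 < p)
    (hg : ∀ s, 0 ≤ s → s ≤ T → g s s = 0) {n : ℕ} (hn : 0 < n) {a b : ℝ} (ha : 0 ≤ a)
    (hab : a ≤ b) (hb : b ≤ T) (hLn : ∀ i, ωb (grid T n a b i) (grid T n a b (i + 1)) ≤ L) :
    ∑ i ∈ Finset.range n, ‖g (grid T n a b i) (grid T n a b (i + 1))‖ ^ p
      ∈ locVarSet g p ωb L a b := by
  have key := locVarSet_sum (g := g) (p := p) (ωb := ωb) (L := L) (τ := grid T n a b) (N := n)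
    (x := fun i => ‖g (grid T n a b i) (grid T n a b (i + 1))‖ ^ p) (fun i _ => by
      rcases (grid_mono hT.le n a b (Nat.le_succ i)).eq_or_lt with h1 | h1
      · rw [Nat.succ_eq_add_one] at h1
        simp only [← h1]
        rw [hg _ (ha.trans (le_grid _ _ _ _)) ((grid_le _ hab _).trans hb), norm_zero,
          Real.zero_rpow hp.ne']
        exact locVarSet_zero g _
      · exact locVarSet_single g h1 (hLn i))
  rwa [grid_zero n b ha, grid_self hn hab hb] at key

theorem locVarSet_nonneg {g : ℝ → ℝ → V} {a b x : ℝ} (hx : x ∈ locVarSet g p ωb L a b) :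
    0 ≤ x := by
  obtain ⟨N, τ, -, -, rfl⟩ := hx
  exact Finset.sum_nonneg fun i _ => Real.rpow_nonneg (norm_nonneg _) _

theorem IsPartition.step_le {s t : ℝ} {N : ℕ} {τ : ℕ → ℝ} (hτ : IsPartition s t N τ) :
    ∀ i < N, τ i ≤ τ (i + 1) := fun i hi => (hτ.2.2 i hi).le

theorem IsPartition.nonneg {t : ℝ} {N : ℕ} {τ : ℕ → ℝ} (hτ : IsPartition 0 t N τ) {i : ℕ}
    (hi : i ≤ N) : 0 ≤ τ i :=
  hτ.1 ▸ le_of_step_le hτ.step_le (Nat.zero_le i) hi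

theorem IsPartition.le {s t : ℝ} {N : ℕ} {τ : ℕ → ℝ} (hτ : IsPartition s t N τ) {i : ℕ}
    (hi : i ≤ N) : τ i ≤ t :=
  (le_of_step_le hτ.step_le hi le_rfl).trans_eq hτ.2.1

theorem IsControl.sum_partition_le (hω : IsControl T ω) {N : ℕ} {τ : ℕ → ℝ}
    (hτ : IsPartition 0 T N τ) : ∑ i ∈ Finset.range N, ω (τ i) (τ (i + 1)) ≤ ω 0 T := by
  have := hω.sum_le hτ.step_le hτ.1.ge hτ.2.1.le
  rwa [hτ.1, hτ.2.1] at this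

theorem bddAbove_locVarSet_of_le {g : ℝ → ℝ → V} {C : ℝ} (hC : 0 ≤ C) (hξ : 0 < ξ)
    (hω : IsControl T ω) (hg : ∀ s t, 0 ≤ s → s ≤ t → t ≤ T → ωb s t ≤ L →
      ‖g s t‖ ≤ C * ω s t ^ (1 / ξ)) :
    BddAbove (locVarSet g ξ ωb L 0 T) := by
  refine ⟨C ^ ξ * ω 0 T, ?_⟩
  rintro x ⟨N, τ, hτ, hadm, rfl⟩
  refine le_trans ?_ (mul_le_mul_of_nonneg_left (hω.sum_partition_le hτ) (by positivity))
  rw [Finset.mul_sum]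
  refine Finset.sum_le_sum fun i hi => ?_
  rw [Finset.mem_range] at hi
  have h0 := hτ.nonneg hi.le
  have h1 := hτ.step_le i hi
  have h2 : τ (i + 1) ≤ T := hτ.le hi
  have hW := hω.nonneg h0 h1 h2
  calc ‖g (τ i) (τ (i + 1))‖ ^ ξ ≤ (C * ω (τ i) (τ (i + 1)) ^ (1 / ξ)) ^ ξ := by
        gcongr
        exact hg _ _ h0 h1 h2 (hadm i hi)
    _ = C ^ ξ * ω (τ i) (τ (i + 1)) := by
        rw [Real.mul_rpow hC (by positivity), ← Real.rpow_mul hW, one_div_mul_cancel hξ.ne',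
          Real.rpow_one]

theorem sum_grid_increments {f : ℝ → V} {n : ℕ} (hn : 0 < n) {a b : ℝ} (ha : 0 ≤ a)
    (hab : a ≤ b) (hb : b ≤ T) :
    ∑ i ∈ Finset.range n, (f (grid T n a b (i + 1)) - f (grid T n a b i)) = f b - f a := by
  rw [Finset.sum_range_sub (fun i => f (grid T n a b i)), grid_zero n b ha, grid_self hn hab hb]

/-- A continuous path whose increments have finite localized `ξ`-variation, `ξ < 1`,
is constant. -/
theorem eq_of_bddAbove_locVarSet_inc (hT : 0 < T) (hL : 0 < L) (hξ0 : 0 < ξ) (hξ1 : ξ < 1)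
    (hωb : IsControl T ωb) {D : ℝ → V} (hD : ContinuousOn D (Icc 0 T))
    (hb : BddAbove (locVarSet (inc D) ξ ωb L 0 T)) {t : ℝ} (ht : t ∈ Icc (0 : ℝ) T) :
    D t = D 0 := by
  obtain ⟨M, hM⟩ := hb
  have hcont : ContinuousOn (fun q : ℝ × ℝ => inc D q.1 q.2) (Simplex T) := by
    unfold inc
    refine (hD.comp continuousOn_snd ?_).sub (hD.comp continuousOn_fst ?_)
    · rintro ⟨a, b⟩ ⟨h1, h2, h3⟩
      exact ⟨h1.trans h2, h3⟩
    · rintro ⟨a, b⟩ ⟨h1, h2, h3⟩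
      exact ⟨h1, h2.trans h3⟩
  have hdiag : ∀ s, 0 ≤ s → s ≤ T → inc D s s = 0 := fun s _ _ => sub_self _
  have key : ∀ η : ℝ, 0 < η → ‖D t - D 0‖ ≤ η ^ (1 - ξ) * M := by
    intro η hη
    obtain ⟨N1, H1⟩ := eventually_grid hT.le (exists_mesh hcont hdiag hη)
    obtain ⟨N2, H2⟩ := eventually_grid hT.le
      (exists_mesh hωb.cont (fun s => hωb.diag (s := s)) hL)
    set n := max N1 N2 + 1
    have hn : 0 < n := Nat.succ_pos _
    have hn1 : N1 ≤ n := by omega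
    have hn2 : N2 ≤ n := by omega
    have hx := locVarSet_grid (ωb := ωb) (L := L) hT hξ0 hdiag hn le_rfl ht.1 ht.2
      (fun i => (le_abs_self _).trans (H2 n hn2 hn 0 t le_rfl ht.1 ht.2 i).le)
    have hy := locVarSet_grid (ωb := ωb) (L := L) hT hξ0 hdiag hn ht.1 ht.2 le_rfl
      (fun i => (le_abs_self _).trans (H2 n hn2 hn t T ht.1 ht.2 le_rfl i).le)
    have hxM := hM (locVarSet_add hx hy)
    have hy0 := locVarSet_nonneg hy
    rw [← sum_grid_increments hn le_rfl ht.1 ht.2]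
    calc _ ≤ ∑ i ∈ Finset.range n, η ^ (1 - ξ) *
          ‖inc D (grid T n 0 t i) (grid T n 0 t (i + 1))‖ ^ ξ := by
          refine norm_sum_le_of_le _ fun i _ => ?_
          change ‖inc D (grid T n 0 t i) (grid T n 0 t (i + 1))‖ ≤ _
          have hs := (H1 n hn1 hn 0 t le_rfl ht.1 ht.2 i).le
          set v := inc D (grid T n 0 t i) (grid T n 0 t (i + 1))
          calc ‖v‖ = ‖v‖ ^ (1 - ξ) * ‖v‖ ^ ξ := by
                rw [← Real.rpow_add_of_nonneg (norm_nonneg _) (by linarith) hξ0.le]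
                simp
            _ ≤ _ := by
                gcongr
      _ ≤ η ^ (1 - ξ) * M := by
          rw [← Finset.mul_sum]
          gcongr
          linarith
  have hc : Filter.Tendsto (fun x : ℝ => x ^ (1 - ξ) * M) (nhdsWithin 0 (Ioi 0)) (nhds 0) := by
    have : ContinuousAt (fun x : ℝ => x ^ (1 - ξ) * M) 0 :=
      (Real.continuousAt_rpow_const _ _ (Or.inr (by linarith))).mul continuousAt_const
    have h2 := this.tendsto
    simp only [Real.zero_rpow (by linarith : 1 - ξ ≠ 0), zero_mul] at h2
    exact h2.mono_left nhdsWithin_le_nhds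
  have := ge_of_tendsto hc (Filter.eventually_of_mem self_mem_nhdsWithin key)
  exact sub_eq_zero.1 (norm_le_zero_iff.1 this)

theorem bddAbove_locVarSet_sub {g₁ g₂ : ℝ → ℝ → V} (hξ0 : 0 < ξ) (hξ1 : ξ < 1) {s t : ℝ}
    (h1 : BddAbove (locVarSet g₁ ξ ωb L s t)) (h2 : BddAbove (locVarSet g₂ ξ ωb L s t)) :
    BddAbove (locVarSet (fun a b => g₁ a b - g₂ a b) ξ ωb L s t) := by
  obtain ⟨M1, hM1⟩ := h1
  obtain ⟨M2, hM2⟩ := h2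
  refine ⟨M1 + M2, ?_⟩
  rintro x ⟨N, τ, hτ, hadm, rfl⟩
  refine le_trans ?_ (add_le_add (hM1 ⟨N, τ, hτ, hadm, rfl⟩) (hM2 ⟨N, τ, hτ, hadm, rfl⟩))
  unfold pSum
  rw [← Finset.sum_add_distrib]
  refine Finset.sum_le_sum fun i _ => ?_
  exact (Real.rpow_le_rpow (norm_nonneg _) (norm_sub_le _ _) hξ0.le).trans
    (Real.rpow_add_le_add_rpow (norm_nonneg _) (norm_nonneg _) hξ0.le hξ1.le)

theorem norm_sum_rpow_le (hp : 0 < p) {n : ℕ} (v : ℕ → V) :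
    ‖∑ i ∈ Finset.range n, v i‖ ^ p ≤ (n : ℝ) ^ p * ∑ i ∈ Finset.range n, ‖v i‖ ^ p := by
  rcases Nat.eq_zero_or_pos n with rfl | hn
  · simp [Real.zero_rpow hp.ne']
  obtain ⟨j, hj, hmax⟩ := Finset.exists_max_image (Finset.range n) (fun i => ‖v i‖)
    ⟨0, Finset.mem_range.2 hn⟩
  have h1 : ‖∑ i ∈ Finset.range n, v i‖ ≤ n * ‖v j‖ := by
    refine (norm_sum_le_of_le _ hmax).trans ?_
    simp
  calc _ ≤ ((n : ℝ) * ‖v j‖) ^ p := by gcongr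
    _ = (n : ℝ) ^ p * ‖v j‖ ^ p := Real.mul_rpow (by positivity) (norm_nonneg _)
    _ ≤ _ := by
        gcongr
        exact Finset.single_le_sum (f := fun i => ‖v i‖ ^ p)
          (fun i _ => Real.rpow_nonneg (norm_nonneg _) _) hj

theorem norm_add_rpow_le (hp : 0 < p) (v w : V) :
    ‖v + w‖ ^ p ≤ 2 ^ p * (‖v‖ ^ p + ‖w‖ ^ p) := by
  have := norm_sum_rpow_le hp (n := 2) (fun i => if i = 0 then v else w)
  simpa [Finset.sum_range_succ] using this

theorem bddAbove_varSet_inc_of_sewing {I : ℝ → V} {C : ℝ} (hC : 0 ≤ C) (hT : 0 < T) (hL : 0 < L)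
    (hξ : 0 < ξ) (hp : ξ ≤ p) (hω : IsControl T ω) (hωb : IsControl T ωb)
    (hd : ∀ s, 0 ≤ s → s ≤ T → h s s = 0)
    (hI : ∀ s t, 0 ≤ s → s ≤ t → t ≤ T → ωb s t ≤ L →
      ‖I t - I s - h s t‖ ≤ C * ω s t ^ (1 / ξ))
    (hb : BddAbove (locVarSet h p ωb L 0 T)) : BddAbove (varSet (inc I) p 0 T) := by
  obtain ⟨M, hM⟩ := hb
  have hp0 : 0 < p := hξ.trans_le hp
  obtain ⟨N2, H2⟩ := eventually_grid hT.le (exists_mesh hωb.cont (fun s => hωb.diag (s := s)) hL)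
  set n := N2 + 1
  have hn : 0 < n := Nat.succ_pos _
  have hLn : ∀ a b, 0 ≤ a → a ≤ b → b ≤ T → ∀ i,
      ωb (grid T n a b i) (grid T n a b (i + 1)) ≤ L := fun a b ha hab hbT i =>
    (le_abs_self _).trans (H2 n (Nat.le_succ _) hn a b ha hab hbT i).le
  set K := C ^ p * ω 0 T ^ (p / ξ - 1)
  have hW : 0 ≤ ω 0 T := hω.nonneg le_rfl hT.le le_rfl
  have hK : 0 ≤ K := by positivity
  have step : ∀ s t, 0 ≤ s → s ≤ t → t ≤ T → ωb s t ≤ L →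
      ‖I t - I s‖ ^ p ≤ 2 ^ p * (‖h s t‖ ^ p + K * ω s t) := by
    intro s t hs hst ht hLst
    have hw := hω.nonneg hs hst ht
    have e := norm_add_rpow_le hp0 (h s t) (I t - I s - h s t)
    rw [add_sub_cancel] at e
    refine e.trans ?_
    gcongr
    calc ‖I t - I s - h s t‖ ^ p ≤ (C * ω s t ^ (1 / ξ)) ^ p := by
          gcongr
          exact hI s t hs hst ht hLst
      _ = C ^ p * ω s t ^ (p / ξ) := by
          rw [Real.mul_rpow hC (by positivity), ← Real.rpow_mul hw]
          congr 2
          ring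
      _ ≤ C ^ p * (ω 0 T ^ (p / ξ - 1) * ω s t) := by
          gcongr
          exact rpow_le_mul_self hw (hω.mono le_rfl hs hst ht le_rfl) ((one_le_div hξ).2 hp)
      _ = K * ω s t := by ring
  refine ⟨(n : ℝ) ^ p * (2 ^ p * (M + K * ω 0 T)), ?_⟩
  rintro x ⟨N, τ, hτ, rfl⟩
  set x : ℕ → ℝ := fun i => ∑ j ∈ Finset.range n,
    ‖h (grid T n (τ i) (τ (i + 1)) j) (grid T n (τ i) (τ (i + 1)) (j + 1))‖ ^ p
  have hx : ∑ i ∈ Finset.range N, x i ≤ M := by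
    have := locVarSet_sum (g := h) (p := p) (ωb := ωb) (L := L) (x := x) (τ := τ) (N := N)
      fun i hi => locVarSet_grid hT hp0 hd hn (hτ.nonneg hi.le) (hτ.step_le i hi) (hτ.le hi)
        (hLn _ _ (hτ.nonneg hi.le) (hτ.step_le i hi) (hτ.le hi))
    rw [hτ.1, hτ.2.1] at this
    exact hM this
  have hi : ∀ i ∈ Finset.range N, ‖inc I (τ i) (τ (i + 1))‖ ^ p
      ≤ (n : ℝ) ^ p * (2 ^ p * (x i + K * ω (τ i) (τ (i + 1)))) := by
    intro i hi
    rw [Finset.mem_range] at hi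
    have h0 := hτ.nonneg hi.le
    have h1 := hτ.step_le i hi
    have h2 : τ (i + 1) ≤ T := hτ.le hi
    unfold inc
    rw [← sum_grid_increments hn h0 h1 h2]
    refine (norm_sum_rpow_le hp0 _).trans ?_
    refine mul_le_mul_of_nonneg_left ?_ (by positivity)
    have hm := grid_mono hT.le n (τ i) (τ (i + 1))
    have hG := hω.sum_le (τ := grid T n (τ i) (τ (i + 1))) (N := n)
      (fun j _ => hm (Nat.le_succ j)) (h0.trans (le_grid _ _ _ _)) ((grid_le _ h1 _).trans h2)
    rw [grid_zero n _ h0, grid_self hn h1 h2] at hG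
    calc _ ≤ ∑ j ∈ Finset.range n, 2 ^ p *
          (‖h (grid T n (τ i) (τ (i + 1)) j) (grid T n (τ i) (τ (i + 1)) (j + 1))‖ ^ p
          + K * ω (grid T n (τ i) (τ (i + 1)) j) (grid T n (τ i) (τ (i + 1)) (j + 1))) :=
          Finset.sum_le_sum fun j _ => step _ _ (h0.trans (le_grid _ _ _ _)) (hm (Nat.le_succ j))
            ((grid_le _ h1 _).trans h2) (hLn _ _ h0 h1 h2 j)
      _ ≤ _ := by
          rw [← Finset.mul_sum, Finset.sum_add_distrib, ← Finset.mul_sum]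
          gcongr
  refine (Finset.sum_le_sum hi).trans ?_
  rw [← Finset.mul_sum, ← Finset.mul_sum, Finset.sum_add_distrib, ← Finset.mul_sum]
  gcongr
  exact hω.sum_partition_le hτ

end Aux

/-- **Localized Sewing Lemma.** Given controls `ω, ω̄`, `ξ ∈ (0,1)`, `L > 0` and
a continuous two-index function `h` with `‖δh_{s,u,t}‖ ≤ ω(s,t)^(1/ξ)` whenever `ω̄(s,t) ≤ L`,
there is a unique path `I` with `I 0 = 0` such that `Λ(s,t) := I t - I s - h(s,t)` has finite
localized `ξ`-variation with respect to `(ω̄,L)`; moreover `‖Λ(s,t)‖ ≤ C_ξ ω(s,t)^(1/ξ)` for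
`ω̄(s,t) ≤ L`, with `C_ξ` depending only on `ξ`, and if `h` has finite localized
`p`-variation for some `p ≥ ξ` then `I` has finite `p`-variation on `[0,T]`. -/
theorem statement6 (ξ : ℝ) (hξ : ξ ∈ Set.Ioo (0 : ℝ) 1) :
    ∃ C : ℝ, 0 < C ∧
      ∀ (V : Type*) [NormedAddCommGroup V] [NormedSpace ℝ V] [CompleteSpace V],
        ∀ T : ℝ, 0 < T → ∀ L : ℝ, 0 < L →
          ∀ ω ωb : ℝ → ℝ → ℝ, IsControl T ω → IsControl T ωb →
            ∀ h : ℝ → ℝ → V,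
              ContinuousOn (fun q : ℝ × ℝ => h q.1 q.2) (Simplex T) →
              (∀ s u t : ℝ, 0 ≤ s → s ≤ u → u ≤ t → t ≤ T → ωb s t ≤ L →
                ‖h s t - h s u - h u t‖ ≤ ω s t ^ (1 / ξ)) →
              ∃ I : ℝ → V,
                I 0 = 0 ∧ ContinuousOn I (Icc 0 T) ∧
                BddAbove (locVarSet (fun a b => I b - I a - h a b) ξ ωb L 0 T) ∧
                (∀ s t : ℝ, (s, t) ∈ Simplex T → ωb s t ≤ L →
                  ‖I t - I s - h s t‖ ≤ C * ω s t ^ (1 / ξ)) ∧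
                (∀ J : ℝ → V, J 0 = 0 → ContinuousOn J (Icc 0 T) →
                  BddAbove (locVarSet (fun a b => J b - J a - h a b) ξ ωb L 0 T) →
                  ∀ t ∈ Icc (0 : ℝ) T, J t = I t) ∧
                (∀ p : ℝ, ξ ≤ p → BddAbove (locVarSet h p ωb L 0 T) →
                  BddAbove (varSet (inc I) p 0 T)) := by
  obtain ⟨hξ0, hξ1⟩ := hξ
  have hθ : 1 < 1 / ξ := (one_lt_div hξ0).2 hξ1
  have hC := sewConst_pos hθ
  refine ⟨sewConst (1 / ξ), hC, ?_⟩
  intro V _ _ _ T hT L hL ω ωb hω hωb h hc hh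
  replace hh : IsAlmostAdditive T L (1 / ξ) ω ωb h := hh
  obtain ⟨I, hI0, hI⟩ := hh.exists_sewing hT hθ hL hω hωb
  have hIc := continuousOn_of_sewing_bound hθ hL hω hωb hh hc hI
  have hIb : BddAbove (locVarSet (fun a b => I b - I a - h a b) ξ ωb L 0 T) :=
    bddAbove_locVarSet_of_le hC.le hξ0 hω hI
  refine ⟨I, hI0, hIc, hIb, fun s t hst => hI s t hst.1 hst.2.1 hst.2.2, ?_, fun p hp hb =>
    bddAbove_varSet_inc_of_sewing hC.le hT hL hξ0 hp hω hωb (hh.diag hθ hL hω hωb) hI hb⟩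
  intro J hJ0 hJc hJb t ht
  have hb := bddAbove_locVarSet_sub hξ0 hξ1 hJb hIb
  have hinc : (fun a b => (J b - J a - h a b) - (I b - I a - h a b)) = inc (fun t => J t - I t) := by
    funext a b
    simp only [inc]
    abel
  rw [hinc] at hb
  have := eq_of_bddAbove_locVarSet_inc hT hL hξ0 hξ1 hωb (hJc.sub hIc) hb ht
  simpa [hJ0, hI0, sub_eq_zero] using this
end
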